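/- Let p be a prime, let n, k, M be natural numbers with 2k ≤ n, n < p, and p > 2M. Let Φ be the 2k × n Vandermonde measurement matrix over Z_p with entries Φ_{i,j} = j^{i-1} for i ∈ {1,…,2k} and j ∈ {1,…,n}. If x, x′ ∈ Z^n each have at most k nonzero entries, all entries of x and x′ have absolute value at most M, and Φ applied to the reduction of x modulo p equals Φ applied to the reduction of x′ modulo p, then x = x′. -/

import Mathlib

/-- A vector supported on at most `m` points is zero as soon as its first `m` power moments at
distinct nodes vanish. -/
theorem eq_zero_of_sum_mul_pow_eq_zero {R ι : Type*} [CommRing R] [IsDomain R]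
    (s : Finset ι) (m : ℕ) (hs : s.card ≤ m) (f w : ι → R) (hf : Set.InjOn f s)
    (h : ∀ i < m, ∑ j ∈ s, w j * f j ^ i = 0) : ∀ j ∈ s, w j = 0 := by
  intro j hj
  have key : (fun a : Fin s.card => w (s.equivFin.symm a)) = 0 := by
    refine Matrix.eq_zero_of_forall_pow_sum_mul_pow_eq_zero
      (f := fun a : Fin s.card => f (s.equivFin.symm a)) ?_ ?_
    · intro a b hab
      exact s.equivFin.symm.injective (Subtype.ext (hf (Subtype.prop _) (Subtype.prop _) hab))
    · intro i
      rw [← h i (i.2.trans_le hs), ← Finset.sum_coe_sort s]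
      exact Equiv.sum_comp s.equivFin.symm (fun a : s => w a * f a ^ (i : ℕ))
  simpa using congrFun key (s.equivFin ⟨j, hj⟩)

/-- Uniqueness of `k`-sparse recovery via the `2k × n` Vandermonde measurement
matrix over `ZMod p` (`Φ_{i,j} = j^{i-1}` in 1-indexed form): two `k`-sparse
integer vectors bounded by `M` with `p > 2M` having equal measurements of their
mod-`p` reductions are equal. -/
theorem vandermonde_sparse_recovery_unique
    (p : ℕ) [Fact p.Prime] (n k M : ℕ) (h2k : 2 * k ≤ n) (hnp : n < p)
    (hpM : 2 * M < p)
    (Φ : Matrix (Fin (2 * k)) (Fin n) (ZMod p))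
    (hΦ : ∀ (i : Fin (2 * k)) (j : Fin n), Φ i j = (((j : ℕ) + 1 : ℕ) : ZMod p) ^ (i : ℕ))
    (x x' : Fin n → ℤ)
    (hxs : (Finset.univ.filter fun j : Fin n => x j ≠ 0).card ≤ k)
    (hx's : (Finset.univ.filter fun j : Fin n => x' j ≠ 0).card ≤ k)
    (hxM : ∀ j, |x j| ≤ (M : ℤ)) (hx'M : ∀ j, |x' j| ≤ (M : ℤ))
    (hmeas : Φ.mulVec (fun j => ((x j : ℤ) : ZMod p)) =
      Φ.mulVec (fun j => ((x' j : ℤ) : ZMod p))) :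
    x = x' := by
  classical
  set s : Finset (Fin n) := (Finset.univ.filter fun j : Fin n => x j ≠ 0) ∪
    (Finset.univ.filter fun j : Fin n => x' j ≠ 0) with hs
  have hcard : s.card ≤ 2 * k := (Finset.card_union_le _ _).trans (by omega)
  have hout : ∀ j, j ∉ s → x j = 0 ∧ x' j = 0 := by
    intro j hj
    simpa [hs] using hj
  have hinj : Function.Injective fun j : Fin n => (((j : ℕ) + 1 : ℕ) : ZMod p) := by
    intro a b hab
    have hmod := (ZMod.natCast_eq_natCast_iff' _ _ _).mp hab
    rw [Nat.mod_eq_of_lt (by omega), Nat.mod_eq_of_lt (by omega)] at hmod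
    exact Fin.ext (by omega)
  have hzero := eq_zero_of_sum_mul_pow_eq_zero s (2 * k) hcard
    (fun j : Fin n => (((j : ℕ) + 1 : ℕ) : ZMod p))
    (fun j => ((x j : ℤ) : ZMod p) - ((x' j : ℤ) : ZMod p)) hinj.injOn (by
      intro i hi
      have hrow := congrFun hmeas ⟨i, hi⟩
      simp only [Matrix.mulVec, dotProduct, hΦ] at hrow
      rw [Finset.sum_subset (Finset.subset_univ s)
        (fun j _ hj => by simp [(hout j hj).1, (hout j hj).2])]
      simp only [sub_mul, Finset.sum_sub_distrib]
      rw [sub_eq_zero]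
      simpa only [mul_comm] using hrow)
  funext j
  by_cases hj : j ∈ s
  · have hdvd : (p : ℤ) ∣ x j - x' j := by
      rw [← ZMod.intCast_zmod_eq_zero_iff_dvd]
      simpa using hzero j hj
    have hx := abs_le.mp (hxM j)
    have hx' := abs_le.mp (hx'M j)
    have hlt : |x j - x' j| < (p : ℤ) := abs_lt.mpr (by constructor <;> omega)
    exact sub_eq_zero.mp (Int.eq_zero_of_abs_lt_dvd hdvd hlt)
  · rw [(hout j hj).1, (hout j hj).2]
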